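/- arXiv:1311.3171 — 2 statements merged into one kernel-verified Lean document; each statement's English description precedes it below -/
import Mathlib

section
/- Any permutation can be routed by setting the switches of the 4-tandem De Bruijn network: for every n ≥ 1 and every permutation π of the set Fin n → Bool, there exists a control-bit assignment σ : Fin (4n) → (Fin n → Bool) → Bool such that, defining for each i the map f_i : (Fin n → Bool) → (Fin n → Bool) by f_i w = if σ i w then (fun j => xor (sr w j) (e j)) else sr w, the composition f_{4n−1} ∘ ⋯ ∘ f_1 ∘ f_0 equals π. -/
/-- Cyclic right shift on bit-vectors: `(sr w) j = w (j - 1)`, indices mod `n`. -/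
def sr {n : ℕ} (w : Fin n → Bool) : Fin n → Bool :=
  fun j => w ⟨(j.val + (n - 1)) % n, Nat.mod_lt _ j.pos⟩

/-- The indicator vector of position 0: `e 0 = true`, `e j = false` otherwise. -/
def ebit {n : ℕ} : Fin n → Bool :=
  fun j => decide (j.val = 0)

namespace DeBruijn

/-! ### Factoring through a schedule of positions -/

/-- `f` factors as a composition of maps, one for each position in `l` (the head acting first),
where the map for position `k` changes no coordinate other than `k`. -/
def Factors {ι : Type*} : List ι → ((ι → Bool) → (ι → Bool)) → Prop
  | [], f => ∀ w, f w = w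
  | k :: l, f => ∃ g f' : (ι → Bool) → (ι → Bool),
    (∀ w, ∀ j ≠ k, g w j = w j) ∧ Factors l f' ∧ ∀ w, f w = f' (g w)

theorem Factors.snoc {ι : Type*} {k : ι} {g : (ι → Bool) → (ι → Bool)}
    (hg : ∀ w, ∀ j ≠ k, g w j = w j) :
    ∀ {l : List ι} {f : (ι → Bool) → (ι → Bool)}, Factors l f →
      Factors (l ++ [k]) (fun w => g (f w))
  | [], _, hf => ⟨g, id, hg, fun _ => rfl, fun w => congrArg g (hf w)⟩
  | _ :: _, _, ⟨h, f', hh, hf', e⟩ =>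
    ⟨h, fun w => g (f' w), hh, hf'.snoc hg, fun w => congrArg g (e w)⟩

/-- Relabelling the coordinates by an involution `r`. -/
theorem Factors.conj {ι : Type*} {r : ι → ι} (hr : Function.Involutive r) :
    ∀ {l : List ι} {f : (ι → Bool) → (ι → Bool)}, Factors l f →
      Factors (l.map r) (fun w => f (w ∘ r) ∘ r)
  | [], f, hf => fun w => by
    funext j
    simp [hf (w ∘ r), hr j]
  | k :: l, f, ⟨g, f', hg, hf', e⟩ => by
    refine ⟨fun w => g (w ∘ r) ∘ r, _, fun w j hj => ?_, hf'.conj hr, fun w => ?_⟩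
    · have : r j ≠ k := fun h => hj (by rw [← h, hr j])
      simp [hg _ _ this, hr j]
    · have : (g (w ∘ r) ∘ r) ∘ r = g (w ∘ r) := by
        funext j
        simp [hr j]
      simp only [this, e]

/-! ### The looping argument -/

/-- Two fixed-point-free involutions admit a common proper two-colouring. -/
theorem exists_common_coloring {X : Type*} (a b : Equiv.Perm X)
    (ha : ∀ x, a (a x) = x) (hb : ∀ x, b (b x) = x) (ha' : ∀ x, a x ≠ x) (hb' : ∀ x, b x ≠ x) :
    ∃ c : X → Bool, (∀ x, c (a x) = !c x) ∧ ∀ x, c (b x) = !c x := by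
  classical
  set τ : Equiv.Perm X := a * b with hτ
  have haa : a * a = 1 := Equiv.ext ha
  have hbb : b * b = 1 := Equiv.ext hb
  have hai : a⁻¹ = a := inv_eq_of_mul_eq_one_left haa
  have hbi : b⁻¹ = b := inv_eq_of_mul_eq_one_left hbb
  have hinv : a * τ * a⁻¹ = τ⁻¹ := by
    rw [hτ, mul_inv_rev, hai, hbi, ← mul_assoc, haa, one_mul]
  have hconj (m : ℤ) (x : X) : (τ ^ (-m)) (a x) = a ((τ ^ m) x) := by
    have h : a * τ ^ m * a⁻¹ = τ ^ (-m) := by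
      rw [← conj_zpow, hinv, inv_zpow, zpow_neg]
    rw [← h]
    simp
  have hne (x : X) : ¬ τ.SameCycle x (a x) := by
    rintro ⟨m, hm⟩
    obtain ⟨j, rfl | rfl⟩ := m.even_or_odd'
    · apply ha' ((τ ^ j) x)
      rw [← hconj, ← hm, ← Equiv.Perm.mul_apply, ← zpow_add]
      congr 2
      ring
    · apply hb' ((τ ^ j) x)
      apply a.injective
      rw [← hconj, ← hm, ← Equiv.Perm.mul_apply, ← Equiv.Perm.mul_apply, ← Equiv.Perm.mul_apply,
        ← zpow_add, ← hτ, ← zpow_one_add]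
      congr 2
      ring
  let q : X → Quotient (Equiv.Perm.SameCycle.setoid τ) := Quotient.mk _
  have hqne (x : X) : q x ≠ q (a x) := fun h => hne x (Quotient.exact h)
  have hqab (x : X) : q (a (b x)) = q x :=
    Quotient.sound (show τ.SameCycle (τ x) x from ⟨-1, by simp⟩)
  have hqb (x : X) : q (b x) = q (a x) := by
    refine Quotient.sound (show τ.SameCycle (b x) (a x) from ⟨1, ?_⟩)
    simp [hτ, hb]
  let : LinearOrder (Quotient (Equiv.Perm.SameCycle.setoid τ)) := linearOrderOfSTO WellOrderingRel
  have hflip (x : X) : decide (q (a x) < q x) = !decide (q x < q (a x)) := by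
    rcases lt_or_gt_of_ne (hqne x) with h | h <;> simp [h, h.le]
  refine ⟨fun x => decide (q x < q (a x)), fun x => ?_, fun x => ?_⟩
  · simpa only [ha] using hflip x
  · simpa only [hqab, hqb] using hflip x

/-- Flipping the coordinate `k`. -/
def flip {ι : Type*} [DecidableEq ι] (k : ι) : Equiv.Perm (ι → Bool) :=
  Function.Involutive.toPerm (fun w => Function.update w k (!w k)) fun w => by simp

theorem flip_apply {ι : Type*} [DecidableEq ι] (k : ι) (w : ι → Bool) :
    flip k w = Function.update w k (!w k) := rfl

/-- Overwriting the coordinate `k` by a colouring that changes under `flip k` is injective. -/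
theorem update_injective {ι : Type*} [DecidableEq ι] {k : ι} {c : (ι → Bool) → Bool}
    (hc : ∀ w, c (flip k w) = !c w) :
    Function.Injective fun w : ι → Bool => Function.update w k (c w) := by
  intro v w h
  have hoff : ∀ j ≠ k, v j = w j := fun j hj => by simpa [hj] using congrFun h j
  have hk : c v = c w := by simpa using congrFun h k
  by_cases hvw : v k = w k
  · funext j
    by_cases hj : j = k
    · rw [hj, hvw]
    · exact hoff j hj
  · have : v = flip k w := by
      funext j
      by_cases hj : j = k
      · subst hj
        simpa [flip_apply, ← Bool.eq_not] using hvw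
      · simpa [flip_apply, hj] using hoff j hj
    rw [this, hc] at hk
    simp at hk

/-- Beneš routing: a permutation that changes only coordinates in `l` factors through the
schedule `l` followed by its reverse. -/
theorem exists_factors_reverse {ι : Type*} [Fintype ι] [DecidableEq ι] :
    ∀ (l : List ι) (ρ : Equiv.Perm (ι → Bool)), (∀ w, ∀ j ∉ l, ρ w j = w j) →
      ∃ f₁ f₂, Factors l f₁ ∧ Factors l.reverse f₂ ∧ ∀ w, ρ w = f₂ (f₁ w)
  | [], ρ, h => ⟨id, id, fun _ => rfl, fun _ => rfl, fun w => funext fun j => h w j (by simp)⟩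
  | k :: l, ρ, h => by
    have hflip (w : ι → Bool) : flip k (flip k w) = w := by simp [flip_apply]
    have hflip' (w : ι → Bool) : flip k w ≠ w := fun e => by simpa [flip_apply] using congrFun e k
    obtain ⟨c, hc, hcρ⟩ := exists_common_coloring (flip k) (ρ⁻¹ * flip k * ρ) hflip
      (fun w => by simp [hflip]) hflip'
      (fun w e => hflip' (ρ w) (Equiv.Perm.inv_eq_iff_eq.1 e))
    have hc' (w : ι → Bool) : c (ρ⁻¹ (flip k w)) = !c (ρ⁻¹ w) := by
      simpa using hcρ (ρ⁻¹ w)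
    let p := Equiv.ofBijective _ (Finite.injective_iff_bijective.1 (update_injective hc))
    let q := Equiv.ofBijective _
      (Finite.injective_iff_bijective.1 (update_injective (c := fun w => c (ρ⁻¹ w)) hc'))
    have hp (w : ι → Bool) : p w = Function.update w k (c w) := rfl
    have hq (w : ι → Bool) : q w = Function.update w k (c (ρ⁻¹ w)) := rfl
    obtain ⟨f₁, f₂, h₁, h₂, e⟩ := exists_factors_reverse l (p.symm.trans (ρ.trans q)) (fun w j hj => by
      obtain ⟨w, rfl⟩ := p.surjective w
      by_cases hjk : j = k
      · subst hjk
        rw [Equiv.trans_apply, Equiv.symm_apply_apply]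
        simp [hp, hq]
      · rw [Equiv.trans_apply, Equiv.symm_apply_apply]
        simpa [hp, hq, hjk] using h w j (by simp [hj, hjk]))
    refine ⟨fun w => f₁ (p w), fun w => q.symm (f₂ w), ⟨p, f₁, fun w j hj => ?_, h₁, fun _ => rfl⟩,
      ?_, fun w => ?_⟩
    · simp [hp, hj]
    · rw [List.reverse_cons]
      refine h₂.snoc fun w j hj => ?_
      obtain ⟨w, rfl⟩ := q.surjective w
      rw [Equiv.symm_apply_apply]
      simp [hq, hj]
    · simp [← e]

/-! ### Reversal of the coordinates -/

/-- Adding, for each `j ∈ l` in turn, the mirror coordinate to coordinate `j`. -/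
theorem factors_xor_rev {n : ℕ} : ∀ l : List (Fin n), l.Pairwise (· > ·) →
    Factors l (fun w j =>
      if j ∈ l ∧ j ≠ j.rev then
        if j < j.rev ∧ j.rev ∈ l then w j.rev else xor (w j) (w j.rev)
      else w j)
  | [], _ => fun w => by simp
  | k :: l, h => by
    rw [List.pairwise_cons] at h
    refine ⟨fun w => if k ≠ k.rev then Function.update w k (xor (w k) (w k.rev)) else w, _,
      fun w j hj => ?_, factors_xor_rev l h.2, fun w => ?_⟩
    · split_ifs <;> simp [hj]
    · funext j
      have hk : k ∉ l := fun hk => lt_irrefl _ (h.1 k hk)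
      have hrr := Fin.rev_rev j
      simp only [List.mem_cons]
      cases hx : w j <;> cases hy : w j.rev <;> grind [Function.update_apply]

/-- Adding, for each `j ∈ l` in the upper half, the mirror coordinate to coordinate `j`. -/
theorem factors_xor_rev_upper {n : ℕ} : ∀ l : List (Fin n), l.Nodup →
    Factors l (fun w j => if j ∈ l ∧ j.rev < j then xor (w j) (w j.rev) else w j)
  | [], _ => fun w => by simp
  | k :: l, h => by
    rw [List.nodup_cons] at h
    refine ⟨fun w => if k.rev < k then Function.update w k (xor (w k) (w k.rev)) else w, _,
      fun w j hj => ?_, factors_xor_rev_upper l h.2, fun w => ?_⟩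
    · split_ifs <;> simp [hj]
    · funext j
      have hrr := Fin.rev_rev j
      simp only [List.mem_cons]
      grind [Function.update_apply]

/-- The positions in the order in which the network exposes them. -/
def positions (n : ℕ) : List (Fin n) := (List.finRange n).reverse

theorem mem_positions {n : ℕ} (j : Fin n) : j ∈ positions n := by simp [positions]

theorem map_rev_positions_reverse (n : ℕ) : (positions n).reverse.map Fin.rev = positions n := by
  simp [positions, List.finRange_reverse, Function.comp_def]

theorem exists_factors_rev (n : ℕ) :
    ∃ f₁ f₂, Factors (positions n) f₁ ∧ Factors (positions n) f₂ ∧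
      ∀ w, f₂ (f₁ w) = w ∘ Fin.rev := by
  have hpos : (positions n).Pairwise (· > ·) := by
    simpa [positions, List.pairwise_reverse] using List.pairwise_lt_finRange n
  refine ⟨_, _, factors_xor_rev _ hpos,
    factors_xor_rev_upper _ (hpos.imp fun h => ne_of_gt h), fun w => funext fun j => ?_⟩
  simp only [mem_positions, Fin.rev_rev, true_and, and_true, Function.comp_apply]
  rcases lt_trichotomy j j.rev with h | h | h
  · simp [h, h.ne, h.not_gt]
  · simp [← h]
  · cases w j <;> cases w j.rev <;> simp [h, h.ne, h.ne', h.not_gt]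

/-! ### The network -/

/-- One column of the network, with control bits `s`. -/
def step {n : ℕ} (v : Fin n → Bool) (s : (Fin n → Bool) → Bool) : Fin n → Bool :=
  if s v then (fun j => xor (sr v j) (ebit j)) else sr v

theorem sr_apply {n : ℕ} [NeZero n] (w : Fin n → Bool) (j : Fin n) : sr w j = w (j - 1) := by
  obtain ⟨m, rfl⟩ := Nat.exists_eq_succ_of_ne_zero (NeZero.ne n)
  refine congrArg w (Fin.ext ?_)
  rcases m with _ | m
  · simp
  · rw [Fin.sub_def, Fin.val_one]
    exact congrArg (· % _) (Nat.add_comm _ _)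

theorem sr_iterate_apply {n : ℕ} [NeZero n] (t : ℕ) (w : Fin n → Bool) (j : Fin n) :
    sr^[t] w j = w (j - t • 1) := by
  induction t generalizing j with
  | zero => simp
  | succ t ih =>
    rw [Function.iterate_succ_apply', sr_apply, ih, succ_nsmul']
    congr 1
    abel

theorem val_nsmul_one {n : ℕ} [NeZero n] (t : ℕ) : (t • (1 : Fin n)).val = t % n := by
  induction t with
  | zero => simp
  | succ t ih => simp [succ_nsmul, Fin.val_add, ih]

theorem sr_iterate_self {n : ℕ} [NeZero n] (w : Fin n → Bool) : sr^[n] w = w := by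
  funext j
  have : n • (1 : Fin n) = 0 := by simpa using card_nsmul_eq_zero' (x := (1 : Fin n))
  rw [sr_iterate_apply, this, sub_zero]

theorem sr_iterate_injective {n : ℕ} [NeZero n] (t : ℕ) :
    Function.Injective (sr^[t] : (Fin n → Bool) → Fin n → Bool) := by
  intro v w h
  funext j
  simpa [sr_iterate_apply] using congrFun h (j + t • 1)

/-- A column started at time `t` can change exactly the coordinate `-(t + 1)` of the
unrotated vector. -/
theorem exists_step_eq {n : ℕ} [NeZero n] {t : ℕ} {k : Fin n} (hk : k + (t + 1) • 1 = 0)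
    {g : (Fin n → Bool) → (Fin n → Bool)} (hg : ∀ w, ∀ j ≠ k, g w j = w j) :
    ∃ s, ∀ w, step (sr^[t] w) s = sr^[t + 1] (g w) := by
  refine ⟨fun v => xor (g (Function.invFun sr^[t] v) k) (Function.invFun sr^[t] v k), fun w => ?_⟩
  funext j
  rw [step, Function.leftInverse_invFun (sr_iterate_injective t) w, sr_iterate_apply,
    ← Function.iterate_succ_apply' sr]
  have hj : j - (t + 1) • 1 = k ↔ j = 0 := by
    rw [sub_eq_iff_eq_add, hk]
  by_cases h0 : j = 0
  · rw [hj.2 h0]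
    have : ebit j = true := by simp [ebit, h0]
    split_ifs with hs
    · simp only [this, sr_iterate_apply, hj.2 h0]
      revert hs
      cases g w k <;> cases w k <;> simp
    · simp only [sr_iterate_apply, hj.2 h0]
      revert hs
      cases g w k <;> cases w k <;> simp
  · have : ebit j = false := by
      simpa [ebit, ← Fin.val_eq_zero_iff] using h0
    rw [hg w _ (mt hj.1 h0)]
    split_ifs <;> simp [this, sr_iterate_apply]

/-- A schedule whose `i`-th position is the one exposed at time `t + i` can be followed by
the network. -/
theorem Factors.exists_foldl_step {n : ℕ} [NeZero n] :
    ∀ {l : List (Fin n)} {f : (Fin n → Bool) → (Fin n → Bool)} (t : ℕ), Factors l f →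
      (∀ (i : ℕ) (hi : i < l.length), l[i] + (t + i + 1) • 1 = 0) →
      ∃ cs : List ((Fin n → Bool) → Bool), cs.length = l.length ∧
        ∀ w, cs.foldl step (sr^[t] w) = sr^[t + l.length] (f w)
  | [], f, t, hf, _ => ⟨[], rfl, fun w => by simp [hf w]⟩
  | k :: l, f, t, ⟨g, f', hg, hf', e⟩, hl => by
    obtain ⟨s, hs⟩ := exists_step_eq (t := t) (hl 0 (by simp)) hg
    obtain ⟨cs, hlen, hcs⟩ := hf'.exists_foldl_step (t + 1) (fun i hi => by
      have := hl (i + 1) (by simpa using hi)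
      rwa [← add_assoc, add_right_comm t i 1] at this)
    refine ⟨s :: cs, by simp [hlen], fun w => ?_⟩
    rw [List.foldl_cons, hs, hcs, e, List.length_cons, add_right_comm, add_assoc]

theorem Factors.exists_foldl_step_positions {n : ℕ} [NeZero n]
    {f : (Fin n → Bool) → (Fin n → Bool)} (hf : Factors (positions n) f) :
    ∃ cs : List ((Fin n → Bool) → Bool), cs.length = n ∧ ∀ w, cs.foldl step w = f w := by
  obtain ⟨cs, hlen, hcs⟩ := hf.exists_foldl_step 0 (fun i hi => by
    have hi' : i < n := by simpa [positions] using hi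
    apply Fin.ext
    have hsum : n - 1 - i + (i + 1) = n := by omega
    simp [positions, Fin.val_add, val_nsmul_one, hsum])
  have hn : (positions n).length = n := by simp [positions]
  refine ⟨cs, hlen.trans hn, fun w => ?_⟩
  simpa [hn, sr_iterate_self] using hcs w

end DeBruijn

open DeBruijn in
/-- Any permutation can be routed by setting the switches of the 4-tandem De Bruijn
network: there is a control-bit assignment `σ` such that the column maps
`f_i w = if σ i w then (fun j => xor (sr w j) (e j)) else sr w` compose
(in order `f_{4n-1} ∘ ⋯ ∘ f_1 ∘ f_0`) to `π`. -/
theorem deBruijn_switch_routing (n : ℕ) (hn : 1 ≤ n) (π : Equiv.Perm (Fin n → Bool)) :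
    ∃ σ : Fin (4 * n) → (Fin n → Bool) → Bool,
      ∀ w : Fin n → Bool,
        (List.finRange (4 * n)).foldl
          (fun v i => if σ i v then (fun j => xor (sr v j) (ebit j)) else sr v) w
          = π w := by
  have : NeZero n := ⟨by omega⟩
  have hrev : Function.Involutive (fun w : Fin n → Bool => w ∘ Fin.rev) := fun w => by
    funext j
    simp
  obtain ⟨f₁, f₂, h₁, h₂, e⟩ := exists_factors_reverse (positions n) (hrev.toPerm * π)
    (fun w j hj => absurd (mem_positions j) hj)
  have h₂' := h₂.conj Fin.rev_involutive
  rw [map_rev_positions_reverse] at h₂'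
  obtain ⟨r₁, r₂, hr₁, hr₂, er⟩ := exists_factors_rev n
  obtain ⟨a, ha, ea⟩ := h₁.exists_foldl_step_positions
  obtain ⟨b, hb, eb⟩ := hr₁.exists_foldl_step_positions
  obtain ⟨c, hc, ec⟩ := hr₂.exists_foldl_step_positions
  obtain ⟨d, hd, ed⟩ := h₂'.exists_foldl_step_positions
  have hlen : (a ++ b ++ c ++ d).length = 4 * n := by
    simp only [List.length_append]
    omega
  have key (w : Fin n → Bool) : (a ++ b ++ c ++ d).foldl step w = π w := by
    have hw : f₂ (f₁ w) = π w ∘ Fin.rev := (e w).symm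
    rw [List.foldl_append, List.foldl_append, List.foldl_append, ea, eb, ec, ed, er]
    have h' := hrev (f₁ w)
    have h'' := hrev (π w)
    simp only at h' h''
    rw [h', hw, h'']
  generalize a ++ b ++ c ++ d = cs at hlen key
  rw [← hlen]
  refine ⟨cs.get, fun w => ?_⟩
  rw [← key w]
  conv_rhs => rw [← List.map_get_finRange cs, List.foldl_map]
  rfl
end

section
/- Starting from the all-false state z, the most significant value bit of the delayed-carry counter first becomes true after exactly 2^{m−1} + m − 1 steps: the least t : ℕ such that (U^[t] z).2 ⟨m−1⟩ = true is t = 2^{m−1} + m − 1. -/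
/-- The delayed-carry counter update on pairs `(c, b)` of carry bits and value bits:
`c' 0 = b 0`, `b' 0 = not (b 0)`, and for `1 ≤ i < m`:
`c' i = b i && c (i-1)`, `b' i = xor (b i) (c (i-1))`. -/
def Udc {m : ℕ} (s : (Fin m → Bool) × (Fin m → Bool)) :
    (Fin m → Bool) × (Fin m → Bool) :=
  (fun i => if i.val = 0 then s.2 i
            else s.2 i && s.1 ⟨i.val - 1, by have := i.isLt; omega⟩,
   fun i => if i.val = 0 then ! s.2 i
            else xor (s.2 i) (s.1 ⟨i.val - 1, by have := i.isLt; omega⟩))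

theorem testBit_succ_eq_xor (n i : ℕ) :
    (n + 1).testBit i = xor (n.testBit i) (decide (2 ^ i ∣ n + 1)) := by
  rw [Nat.testBit_eq_decide_div_mod_eq, Nat.testBit_eq_decide_div_mod_eq, Nat.succ_div]
  by_cases h : 2 ^ i ∣ n + 1
  · rcases Nat.mod_two_eq_zero_or_one (n / 2 ^ i) with h' | h' <;>
      simp [h, h', Nat.add_mod]
  · simp [h]

theorem two_pow_succ_dvd_succ_iff (n i : ℕ) :
    2 ^ (i + 1) ∣ n + 1 ↔ n.testBit i = true ∧ 2 ^ i ∣ n + 1 := by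
  have hdiv := Nat.succ_div (a := n) (b := 2 ^ i)
  rw [Nat.testBit_eq_decide_div_mod_eq, decide_eq_true_iff]
  constructor
  · intro h
    have hi : 2 ^ i ∣ n + 1 := (pow_dvd_pow 2 (Nat.le_succ i)).trans h
    refine ⟨?_, hi⟩
    rw [if_pos hi] at hdiv
    have h2 : 2 ∣ (n + 1) / 2 ^ i := Nat.dvd_div_of_mul_dvd (by rwa [← pow_succ])
    omega
  · rintro ⟨hodd, hi⟩
    rw [if_pos hi] at hdiv
    rw [pow_succ]
    exact Nat.mul_dvd_of_dvd_div hi (by omega)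

/-- Closed form of the counter: position `i` lags `i` steps behind an ordinary binary counter. -/
theorem iterate_Udc_false (m t : ℕ) :
    Udc^[t] ((fun _ => false, fun _ => false) : (Fin m → Bool) × (Fin m → Bool)) =
      (fun i => decide (0 < t - i.val ∧ 2 ^ (i.val + 1) ∣ t - i.val),
       fun i => (t - i.val).testBit i.val) := by
  induction t with
  | zero => simp
  | succ t ih =>
    rw [Function.iterate_succ_apply', ih]
    refine Prod.ext (funext fun ⟨i, hi⟩ => ?_) (funext fun ⟨i, hi⟩ => ?_)
    · rcases i with _ | i
      · have := two_pow_succ_dvd_succ_iff t 0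
        simp only [Udc]
        rw [Bool.eq_iff_iff]
        simp_all
      · rcases le_or_gt (i + 1) t with h | h
        · obtain ⟨n, rfl⟩ := Nat.exists_eq_add_of_le h
          have h1 : i + 1 + n - (i + 1) = n := by omega
          have h2 : i + 1 + n - i = n + 1 := by omega
          have h3 : i + 1 + n + 1 - (i + 1) = n + 1 := by omega
          have h4 : i < i + 1 + n := by omega
          simp [Udc, h1, h2, h3, h4, two_pow_succ_dvd_succ_iff n (i + 1)]
        · have h1 : t - (i + 1) = 0 := by omega
          have h2 : t - i = 0 := by omega
          simp [Udc, h1, h2, Nat.le_of_lt_succ h]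
    · rcases i with _ | i
      · simpa [Udc] using (testBit_succ_eq_xor t 0).symm
      · rcases le_or_gt (i + 1) t with h | h
        · obtain ⟨n, rfl⟩ := Nat.exists_eq_add_of_le h
          have h1 : i + 1 + n - (i + 1) = n := by omega
          have h2 : i + 1 + n - i = n + 1 := by omega
          have h3 : i + 1 + n + 1 - (i + 1) = n + 1 := by omega
          have h4 : i < i + 1 + n := by omega
          simp [Udc, h1, h2, h3, h4, testBit_succ_eq_xor n (i + 1)]
        · have h1 : t - (i + 1) = 0 := by omega
          have h2 : t - i = 0 := by omega
          simp [Udc, h1, h2, Nat.le_of_lt_succ h]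

/-- Starting from the all-false state, the most significant value bit of the
delayed-carry counter first becomes true after exactly `2^(m-1) + m - 1` steps. -/
theorem delayedCarry_msb_first_true (m : ℕ) (hm : 1 ≤ m) :
    IsLeast
      {t : ℕ | (Udc^[t] ((fun _ => false, fun _ => false) :
          (Fin m → Bool) × (Fin m → Bool))).2 ⟨m - 1, by omega⟩ = true}
      (2 ^ (m - 1) + m - 1) := by
  simp only [iterate_Udc_false]
  have hpos : 0 < 2 ^ (m - 1) := by positivity
  constructor
  · have h : 2 ^ (m - 1) + m - 1 - (m - 1) = 2 ^ (m - 1) := by omega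
    simp [h]
  · intro t ht
    have hle : 2 ^ (m - 1) ≤ t - (m - 1) := Nat.ge_two_pow_of_testBit ht
    omega
end
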